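/- Let d ≥ 3 and g(x) = |x|^{2-d}. Let μ be a probability measure on ℝ^d with bounded density, let (x₁,...,x_N) ∈ (ℝ^d)^N, and let φ be a compactly supported Lipschitz function on ℝ^d. Then F_N^μ(x₁,...,x_N) + C₀ ‖μ‖_{L^∞} N^{2-2/d} ≥ 0 and |∫ φ d(Σ_{i=1}^N δ_{x_i} - Nμ)| ≤ C ‖∇φ‖_{L^∞} ( |supp φ|^{1/2} (F_N^μ(x₁,...,x_N) + C₀ ‖μ‖_{L^∞} N^{2-2/d})^{1/2} + N^{1-1/d} ), where C and C₀ depend only on d and ‖μ‖_{L^∞}. -/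

import Mathlib

open MeasureTheory Filter Topology
open scoped ENNReal NNReal

noncomputable section

/-- The ambient Euclidean space `ℝ^d`. -/
abbrev Esp (d : ℕ) := EuclideanSpace ℝ (Fin d)

/-- The real-valued Coulomb kernel `g(x) = |x|^(2-d)`, `d ≥ 3`. -/
def gC (d : ℕ) (x : Esp d) : ℝ := ‖x‖ ^ (2 - (d : ℝ))

/-- The `[0,∞]`-valued Coulomb kernel (equal to `+∞` at the origin). -/
def coulK (d : ℕ) (x : Esp d) : ℝ≥0∞ := (ENNReal.ofReal ‖x‖) ^ (2 - (d : ℝ))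

/-- The electrostatic potential `h^μ(x) = ∫ g(x-y) dμ(y)` (Bochner integral). -/
def hpot (d : ℕ) (μ : Measure (Esp d)) (x : Esp d) : ℝ :=
  ∫ y, gC d (x - y) ∂μ

/-- The interaction energy `∬ g(x-y) dμ(x) dμ(y)` (Bochner integral). -/
def Dg (d : ℕ) (μ : Measure (Esp d)) : ℝ :=
  ∫ p : Esp d × Esp d, gC d (p.1 - p.2) ∂(μ.prod μ)

/-- The next-order energy
`F_N^μ(X_N) = ∬_{Δᶜ} g(x-y) d(Σᵢ δ_{x_i} - Nμ)(x) d(Σᵢ δ_{x_i} - Nμ)(y)`, i.e.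
`Σ_{i≠j} g(x_i-x_j) - 2N Σᵢ h^μ(x_i) + N² ∬ g dμdμ`, valued in the extended reals
(`+∞` when two points coincide). -/
def FN3 (d N : ℕ) (μ : Measure (Esp d)) (X : Fin N → Esp d) : EReal :=
  (((∑ i, ∑ j, if i ≠ j then coulK d (X i - X j) else 0) : ℝ≥0∞) : EReal)
    + ((- 2 * N * ∑ i, hpot d μ (X i) + (N : ℝ) ^ 2 * Dg d μ : ℝ) : EReal)

/-- The fluctuation of the linear statistic associated with `φ`:
`∫ φ d(Σᵢ δ_{x_i} - Nμ) = Σᵢ φ(xᵢ) - N ∫ φ dμ`. -/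
def fluctInt (d N : ℕ) (μ : Measure (Esp d)) (X : Fin N → Esp d) (φ : Esp d → ℝ) : ℝ :=
  (∑ i, φ (X i)) - N * ∫ x, φ x ∂μ

/-- The (unnormalised) heat kernel `(π/t)^{d/2} exp(-|x|²/(4t))`. -/
def heatK (d : ℕ) (t : ℝ) (x : Esp d) : ℝ :=
  (Real.pi / t) ^ ((d : ℝ) / 2) * Real.exp (-‖x‖ ^ 2 / (4 * t))

/-- The total mass of the heat kernel. -/
def heatMass (d : ℕ) : ℝ := (4 * Real.pi ^ 2) ^ ((d : ℝ) / 2)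

lemma heatMass_pos (d : ℕ) : 0 < heatMass d := by
  unfold heatMass; positivity

lemma heatK_nonneg (d : ℕ) {t : ℝ} (ht : 0 < t) (x : Esp d) : 0 ≤ heatK d t x := by
  unfold heatK; positivity

lemma continuous_heatK (d : ℕ) (t : ℝ) : Continuous (heatK d t) := by
  unfold heatK; fun_prop

lemma measurable_heatK_uncurry (d : ℕ) :
    Measurable (fun p : Esp d × ℝ => heatK d p.2 p.1) := by
  unfold heatK; fun_prop

lemma heatK_neg (d : ℕ) (t : ℝ) (x : Esp d) : heatK d t (-x) = heatK d t x := by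
  simp [heatK]

lemma integrable_gaussian (d : ℕ) {t : ℝ} (ht : 0 < t) :
    Integrable (fun ξ : Esp d => Real.exp (-t * ‖ξ‖ ^ 2)) := by
  have h := (GaussianFourier.integrable_cexp_neg_mul_sq_norm_add (b := (t : ℂ)) (V := Esp d)
    (by simpa using ht) 0 0).re
  refine h.congr (Eventually.of_forall fun ξ => ?_)
  have : (-(t : ℂ) * (‖ξ‖ : ℂ) ^ 2 + 0 * ((inner ℝ (0 : Esp d) ξ : ℝ) : ℂ))
      = ((-t * ‖ξ‖ ^ 2 : ℝ) : ℂ) := by push_cast; ring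
  simp only [this]
  rw [← Complex.ofReal_exp]
  exact Complex.ofReal_re _

lemma integral_gaussian_mul_cos (d : ℕ) {t : ℝ} (ht : 0 < t) (x : Esp d) :
    ∫ ξ : Esp d, Real.exp (-t * ‖ξ‖ ^ 2) * Real.cos (inner ℝ ξ x) = heatK d t x := by
  have h1 := GaussianFourier.integral_cexp_neg_mul_sq_norm_add (b := (t : ℂ)) (V := Esp d)
    (by simpa using ht) Complex.I x
  have h2 := GaussianFourier.integrable_cexp_neg_mul_sq_norm_add (b := (t : ℂ)) (V := Esp d)
    (by simpa using ht) Complex.I x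
  have h3 := congrArg Complex.re h1
  have h4 := integral_re h2
  simp only [RCLike.re_eq_complex_re] at h4
  rw [← h4] at h3
  have e1 : ∀ ξ : Esp d, (Complex.exp (-(t : ℂ) * (‖ξ‖ : ℂ) ^ 2
      + Complex.I * ((inner ℝ x ξ : ℝ) : ℂ))).re
      = Real.exp (-t * ‖ξ‖ ^ 2) * Real.cos (inner ℝ ξ x) := by
    intro ξ
    rw [Complex.exp_re, real_inner_comm]
    congr 2
    · simp [← Complex.ofReal_pow]
    · simp [← Complex.ofReal_pow]
  simp only [e1] at h3
  rw [h3]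
  have e2 : ((Real.pi : ℂ) / t) ^ ((Module.finrank ℝ (Esp d) : ℂ) / 2)
      * Complex.exp (Complex.I ^ 2 * (‖x‖ : ℂ) ^ 2 / (4 * t)) = ((heatK d t x : ℝ) : ℂ) := by
    unfold heatK
    rw [Complex.ofReal_mul, Complex.ofReal_cpow (by positivity)]
    simp
  rw [e2, Complex.ofReal_re]

lemma heatK_eq_exp (d : ℕ) (t : ℝ) (x : Esp d) :
    heatK d t x = (Real.pi / t) ^ ((d : ℝ) / 2) * Real.exp (-(1 / (4 * t)) * ‖x‖ ^ 2) := by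
  unfold heatK
  congr 2
  ring

lemma integrable_heatK (d : ℕ) {t : ℝ} (ht : 0 < t) : Integrable (heatK d t) := by
  have := (integrable_gaussian d (t := 1 / (4 * t)) (by positivity)).const_mul
    ((Real.pi / t) ^ ((d : ℝ) / 2))
  refine this.congr (Eventually.of_forall fun x => ?_)
  simp only [heatK_eq_exp]

lemma integral_heatK (d : ℕ) {t : ℝ} (ht : 0 < t) : ∫ x, heatK d t x = heatMass d := by
  simp only [heatK_eq_exp]
  rw [integral_const_mul, GaussianFourier.integral_rexp_neg_mul_sq_norm (by positivity),
    finrank_euclideanSpace_fin, ← Real.mul_rpow (by positivity) (by positivity), heatMass]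
  congr 1
  field_simp

lemma sq_mul_heatK_le (d : ℕ) {t : ℝ} (ht : 0 < t) (x : Esp d) :
    ‖x‖ ^ 2 * heatK d t x ≤ 8 * t * 2 ^ ((d : ℝ) / 2) * heatK d (2 * t) x := by
  have h1 : ‖x‖ ^ 2 / (8 * t) ≤ Real.exp (‖x‖ ^ 2 / (8 * t)) := by
    linarith [Real.add_one_le_exp (‖x‖ ^ 2 / (8 * t))]
  have h2 : ‖x‖ ^ 2 ≤ 8 * t * Real.exp (‖x‖ ^ 2 / (8 * t)) := by
    rw [div_le_iff₀ (by positivity)] at h1; linarith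
  have h3 : 2 ^ ((d : ℝ) / 2) * heatK d (2 * t) x
      = (Real.pi / t) ^ ((d : ℝ) / 2) * Real.exp (-‖x‖ ^ 2 / (8 * t)) := by
    unfold heatK
    rw [← mul_assoc, ← Real.mul_rpow (by positivity) (by positivity)]
    congr 2
    · field_simp
    · ring_nf
  have h4 : Real.exp (-‖x‖ ^ 2 / (8 * t))
      = Real.exp (‖x‖ ^ 2 / (8 * t)) * Real.exp (-‖x‖ ^ 2 / (4 * t)) := by
    rw [← Real.exp_add]; congr 1; field_simp; ring
  rw [mul_assoc, h3, h4]
  calc ‖x‖ ^ 2 * heatK d t x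
      ≤ 8 * t * Real.exp (‖x‖ ^ 2 / (8 * t)) * heatK d t x :=
        mul_le_mul_of_nonneg_right h2 (heatK_nonneg d ht x)
    _ = _ := by unfold heatK; ring

lemma integrable_sq_mul_heatK (d : ℕ) {t : ℝ} (ht : 0 < t) :
    Integrable (fun x : Esp d => ‖x‖ ^ 2 * heatK d t x) := by
  refine Integrable.mono' ((integrable_heatK d (t := 2 * t) (by positivity)).const_mul
    (8 * t * 2 ^ ((d : ℝ) / 2))) ?_ (Eventually.of_forall fun x => ?_)
  · exact ((continuous_norm.pow 2).mul (continuous_heatK d t)).aestronglyMeasurable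
  · rw [Real.norm_of_nonneg (mul_nonneg (by positivity) (heatK_nonneg d ht x))]
    exact sq_mul_heatK_le d ht x

/-- The constant in the bound on the second moment of the heat kernel. -/
def momC (d : ℕ) : ℝ := 8 * 2 ^ ((d : ℝ) / 2) * heatMass d

lemma momC_pos (d : ℕ) : 0 < momC d := by
  have := heatMass_pos d
  unfold momC; positivity

lemma integral_sq_mul_heatK_le (d : ℕ) {t : ℝ} (ht : 0 < t) :
    ∫ x : Esp d, ‖x‖ ^ 2 * heatK d t x ≤ momC d * t := by
  calc ∫ x : Esp d, ‖x‖ ^ 2 * heatK d t x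
      ≤ ∫ x, 8 * t * 2 ^ ((d : ℝ) / 2) * heatK d (2 * t) x :=
        integral_mono (integrable_sq_mul_heatK d ht)
          ((integrable_heatK d (by positivity)).const_mul _) (sq_mul_heatK_le d ht)
    _ = momC d * t := by
        rw [integral_const_mul, integral_heatK d (by positivity), momC]; ring

/-- The cosine transform of the weighted measure `f α`. -/
def cosT {d : ℕ} (α : Measure (Esp d)) (f : Esp d → ℝ) (ξ : Esp d) : ℝ :=
  ∫ x, f x * Real.cos (inner ℝ ξ x) ∂α

/-- The sine transform of the weighted measure `f α`. -/
def sinT {d : ℕ} (α : Measure (Esp d)) (f : Esp d → ℝ) (ξ : Esp d) : ℝ :=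
  ∫ x, f x * Real.sin (inner ℝ ξ x) ∂α

/-- The real part of the product of the Fourier transform of `f α` with the conjugate of that of
`g β`. -/
def pairT {d : ℕ} (α : Measure (Esp d)) (f : Esp d → ℝ) (β : Measure (Esp d)) (g : Esp d → ℝ)
    (ξ : Esp d) : ℝ :=
  cosT α f ξ * cosT β g ξ + sinT α f ξ * sinT β g ξ

/-- The kernel whose Fourier transform is the weight `w`. -/
def fourK {d : ℕ} (w : Esp d → ℝ) (z : Esp d) : ℝ := ∫ ξ, w ξ * Real.cos (inner ℝ ξ z)

section Pairing

variable {d : ℕ} {α β : Measure (Esp d)} {f g w : Esp d → ℝ}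

lemma integrable_mul_cos_inner (hf : Integrable f α) (ξ : Esp d) :
    Integrable (fun x => f x * Real.cos (inner ℝ ξ x)) α := by
  refine hf.mul_bdd (c := 1) ?_ (Eventually.of_forall fun x => Real.abs_cos_le_one _)
  exact (Real.continuous_cos.comp (continuous_const.inner continuous_id)).aestronglyMeasurable

lemma integrable_mul_sin_inner (hf : Integrable f α) (ξ : Esp d) :
    Integrable (fun x => f x * Real.sin (inner ℝ ξ x)) α := by
  refine hf.mul_bdd (c := 1) ?_ (Eventually.of_forall fun x => Real.abs_sin_le_one _)
  exact (Real.continuous_sin.comp (continuous_const.inner continuous_id)).aestronglyMeasurable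

lemma pairT_eq_integral_prod [SFinite α] [SFinite β] (hf : Integrable f α) (hg : Integrable g β)
    (ξ : Esp d) :
    pairT α f β g ξ
      = ∫ p, f p.1 * g p.2 * Real.cos (inner ℝ ξ (p.1 - p.2)) ∂(α.prod β) := by
  unfold pairT cosT sinT
  rw [← integral_prod_mul, ← integral_prod_mul, ← integral_add]
  · congr 1 with p
    rw [inner_sub_right, Real.cos_sub]
    ring
  · exact (integrable_mul_cos_inner hf ξ).mul_prod (integrable_mul_cos_inner hg ξ)
  · exact (integrable_mul_sin_inner hf ξ).mul_prod (integrable_mul_sin_inner hg ξ)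

lemma integrable_pairing_prod [SFinite α] [SFinite β] (hf : Integrable f α)
    (hg : Integrable g β) (hw : Integrable w) :
    Integrable (fun q : Esp d × (Esp d × Esp d) =>
      w q.1 * (f q.2.1 * g q.2.2) * Real.cos (inner ℝ q.1 (q.2.1 - q.2.2)))
      (volume.prod (α.prod β)) := by
  refine (hw.mul_prod (hf.mul_prod hg)).mul_bdd (c := 1) ?_
    (Eventually.of_forall fun x => Real.abs_cos_le_one _)
  exact Continuous.aestronglyMeasurable (by fun_prop)

lemma integrable_mul_pairT [SFinite α] [SFinite β] (hf : Integrable f α)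
    (hg : Integrable g β) (hw : Integrable w) :
    Integrable (fun ξ => w ξ * pairT α f β g ξ) := by
  refine (integrable_pairing_prod hf hg hw).integral_prod_left.congr
    (Eventually.of_forall fun ξ => ?_)
  simp only [pairT_eq_integral_prod hf hg, ← integral_const_mul]
  congr 1 with p
  ring

lemma integrable_mul_fourK [SFinite α] [SFinite β] (hf : Integrable f α)
    (hg : Integrable g β) (hw : Integrable w) :
    Integrable (fun p : Esp d × Esp d => f p.1 * g p.2 * fourK w (p.1 - p.2)) (α.prod β) := by
  refine (integrable_pairing_prod hf hg hw).integral_prod_right.congr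
    (Eventually.of_forall fun ξ => ?_)
  simp only [fourK, ← integral_const_mul]
  congr 1 with p
  ring

lemma integral_mul_pairT [SFinite α] [SFinite β] (hf : Integrable f α)
    (hg : Integrable g β) (hw : Integrable w) :
    ∫ ξ, w ξ * pairT α f β g ξ
      = ∫ p, f p.1 * g p.2 * fourK w (p.1 - p.2) ∂(α.prod β) := by
  have h := integral_integral_swap (μ := volume) (ν := α.prod β)
    (f := fun (ξ : Esp d) (p : Esp d × Esp d) =>
      w ξ * (f p.1 * g p.2) * Real.cos (inner ℝ ξ (p.1 - p.2)))
    (integrable_pairing_prod hf hg hw)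
  convert! h using 2
  · funext ξ
    simp only [pairT_eq_integral_prod hf hg, ← integral_const_mul]
    congr 1 with p
    ring
  · funext p
    simp only [fourK, ← integral_const_mul]
    congr 1 with p
    ring

end Pairing

/-- The part of the Coulomb kernel carried by the times `t > s`. -/
def tailK (d : ℕ) (s : ℝ) (x : Esp d) : ℝ := ∫ t in Set.Ioi s, heatK d t x

/-- The part of the Coulomb kernel carried by the times `0 < t ≤ s`. -/
def headK (d : ℕ) (s : ℝ) (x : Esp d) : ℝ := ∫ t in Set.Ioc 0 s, heatK d t x

/-- The constant relating the time integral of the heat kernel to the Coulomb kernel. -/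
def coulC (d : ℕ) : ℝ :=
  Real.pi ^ ((d : ℝ) / 2) * (4 ^ ((d : ℝ) / 2 - 1) * Real.Gamma ((d : ℝ) / 2 - 1))

/-- The Fourier weight of `tailK`. -/
def coulW (d : ℕ) (s : ℝ) (ξ : Esp d) : ℝ := ∫ t in Set.Ioi s, Real.exp (-t * ‖ξ‖ ^ 2)

section Kernel

variable {d : ℕ}

lemma half_dim_gt_one (hd : 3 ≤ d) : 1 < (d : ℝ) / 2 := by
  have : (3 : ℝ) ≤ d := by exact_mod_cast hd
  linarith

lemma coulC_pos (hd : 3 ≤ d) : 0 < coulC d := by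
  have := half_dim_gt_one hd
  have := Real.Gamma_pos_of_pos (s := (d : ℝ) / 2 - 1) (by linarith)
  unfold coulC; positivity

lemma gC_nonneg (x : Esp d) : 0 ≤ gC d x := by
  unfold gC; positivity

lemma gC_zero (hd : 3 ≤ d) : gC d 0 = 0 := by
  have : (3 : ℝ) ≤ d := by exact_mod_cast hd
  unfold gC
  rw [norm_zero, Real.zero_rpow (by linarith)]

lemma measurable_gC : Measurable (gC d) := by
  unfold gC; fun_prop

lemma integral_Ioi_heatK (hd : 3 ≤ d) {x : Esp d} (hx : x ≠ 0) :
    ∫ t in Set.Ioi (0 : ℝ), heatK d t x = coulC d * gC d x := by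
  have hd' := half_dim_gt_one hd
  have hr : 0 < ‖x‖ := norm_pos_iff.mpr hx
  rw [← MeasureTheory.integral_comp_rpow_Ioi (fun t => heatK d t x) (p := -1) (by norm_num)]
  have h1 : ∀ u ∈ Set.Ioi (0 : ℝ), (|(-1 : ℝ)| * u ^ ((-1 : ℝ) - 1)) • heatK d (u ^ (-1 : ℝ)) x
      = Real.pi ^ ((d : ℝ) / 2) *
        (u ^ (((d : ℝ) / 2 - 1) - 1) * Real.exp (-(‖x‖ ^ 2 / 4 * u))) := by
    intro u hu
    have hu : 0 < u := hu
    have e1 : u ^ (((d : ℝ) / 2 - 1) - 1) = u ^ ((-1 : ℝ) - 1) * u ^ ((d : ℝ) / 2) := by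
      rw [← Real.rpow_add hu]; congr 1; ring
    have e2 : (Real.pi / u ^ (-1 : ℝ)) ^ ((d : ℝ) / 2)
        = Real.pi ^ ((d : ℝ) / 2) * u ^ ((d : ℝ) / 2) := by
      rw [Real.rpow_neg_one, div_inv_eq_mul, Real.mul_rpow Real.pi_pos.le hu.le]
    have e3 : -‖x‖ ^ 2 / (4 * u ^ (-1 : ℝ)) = -(‖x‖ ^ 2 / 4 * u) := by
      rw [Real.rpow_neg_one]; field_simp
    rw [heatK, e1, e2, e3, smul_eq_mul, abs_neg, abs_one]
    ring
  rw [setIntegral_congr_fun measurableSet_Ioi h1, integral_const_mul,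
    Real.integral_rpow_mul_exp_neg_mul_Ioi (by linarith) (by positivity), coulC, gC]
  have e4 : (1 / (‖x‖ ^ 2 / 4)) ^ ((d : ℝ) / 2 - 1)
      = 4 ^ ((d : ℝ) / 2 - 1) * ‖x‖ ^ (2 - (d : ℝ)) := by
    rw [one_div_div, Real.div_rpow (by norm_num) (by positivity), ← Real.rpow_natCast,
      ← Real.rpow_mul hr.le, div_eq_mul_inv, ← Real.rpow_neg hr.le]
    congr 2
    push_cast; ring
  rw [e4]; ring

lemma integrableOn_heatK_Ioi_zero (hd : 3 ≤ d) {x : Esp d} (hx : x ≠ 0) :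
    IntegrableOn (fun t => heatK d t x) (Set.Ioi (0 : ℝ)) := by
  by_contra h
  have h1 := integral_Ioi_heatK hd hx
  rw [integral_undef h] at h1
  have h2 := coulC_pos hd
  have h3 : 0 < gC d x := Real.rpow_pos_of_pos (norm_pos_iff.mpr hx) _
  have := mul_pos h2 h3
  linarith

lemma tailK_nonneg {s : ℝ} (hs : 0 < s) (x : Esp d) : 0 ≤ tailK d s x :=
  setIntegral_nonneg measurableSet_Ioi fun _ ht => heatK_nonneg d (hs.trans ht) x

lemma headK_nonneg (s : ℝ) (x : Esp d) : 0 ≤ headK d s x :=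
  setIntegral_nonneg measurableSet_Ioc fun _ ht => heatK_nonneg d ht.1 x

lemma tailK_add_headK (hd : 3 ≤ d) {s : ℝ} (hs : 0 < s) {x : Esp d} (hx : x ≠ 0) :
    tailK d s x + headK d s x = coulC d * gC d x := by
  have h := integrableOn_heatK_Ioi_zero hd hx
  rw [← integral_Ioi_heatK hd hx, ← Set.Ioc_union_Ioi_eq_Ioi hs.le,
    setIntegral_union Set.Ioc_disjoint_Ioi_same measurableSet_Ioi
      (h.mono_set Set.Ioc_subset_Ioi_self) (h.mono_set (Set.Ioi_subset_Ioi hs.le)), add_comm]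
  rfl

lemma coulC_mul_gC_le (hd : 3 ≤ d) {s : ℝ} (hs : 0 < s) (x : Esp d) :
    coulC d * gC d x ≤ tailK d s x + headK d s x := by
  by_cases hx : x = 0
  · subst hx
    rw [gC_zero hd, mul_zero]
    exact add_nonneg (tailK_nonneg hs _) (headK_nonneg _ _)
  · exact (tailK_add_headK hd hs hx).ge

lemma tailK_le_coulC_mul_gC (hd : 3 ≤ d) {s : ℝ} (hs : 0 < s) {x : Esp d} (hx : x ≠ 0) :
    tailK d s x ≤ coulC d * gC d x := by
  rw [← tailK_add_headK hd hs hx]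
  linarith [headK_nonneg s x]

lemma integrableOn_pi_div_rpow (hd : 3 ≤ d) {s : ℝ} (hs : 0 < s) :
    IntegrableOn (fun t : ℝ => (Real.pi / t) ^ ((d : ℝ) / 2)) (Set.Ioi s) := by
  have hd' := half_dim_gt_one hd
  have := (integrableOn_Ioi_rpow_of_lt (a := -((d : ℝ) / 2)) (by linarith) hs).const_mul
    (Real.pi ^ ((d : ℝ) / 2))
  refine IntegrableOn.congr_fun this (fun t ht => ?_) measurableSet_Ioi
  have ht : 0 < t := hs.trans ht
  rw [Real.div_rpow Real.pi_pos.le ht.le, Real.rpow_neg ht.le, ← div_eq_mul_inv]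

/-- The constant in the uniform bound on `tailK`. -/
def tailC (d : ℕ) : ℝ := Real.pi ^ ((d : ℝ) / 2) / ((d : ℝ) / 2 - 1)

lemma tailC_pos (hd : 3 ≤ d) : 0 < tailC d := by
  have := half_dim_gt_one hd
  have : 0 < (d : ℝ) / 2 - 1 := by linarith
  unfold tailC; positivity

lemma integral_pi_div_rpow (hd : 3 ≤ d) {s : ℝ} (hs : 0 < s) :
    ∫ t in Set.Ioi s, (Real.pi / t) ^ ((d : ℝ) / 2) = tailC d * s ^ (1 - (d : ℝ) / 2) := by
  have hd' := half_dim_gt_one hd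
  have h1 : ∀ t ∈ Set.Ioi s, (Real.pi / t) ^ ((d : ℝ) / 2)
      = Real.pi ^ ((d : ℝ) / 2) * t ^ (-((d : ℝ) / 2)) := by
    intro t ht
    have ht : 0 < t := hs.trans ht
    rw [Real.div_rpow Real.pi_pos.le ht.le, Real.rpow_neg ht.le, div_eq_mul_inv]
  rw [setIntegral_congr_fun measurableSet_Ioi h1, integral_const_mul,
    integral_Ioi_rpow_of_lt (by linarith) hs, tailC]
  have e1 : -((d : ℝ) / 2) + 1 = 1 - (d : ℝ) / 2 := by ring
  have e2 : (d : ℝ) / 2 - 1 = -(1 - (d : ℝ) / 2) := by ring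
  rw [e1, e2, neg_div, div_neg]
  ring

lemma heatK_le (d : ℕ) {t : ℝ} (ht : 0 < t) (x : Esp d) :
    heatK d t x ≤ (Real.pi / t) ^ ((d : ℝ) / 2) := by
  unfold heatK
  refine mul_le_of_le_one_right (by positivity) (Real.exp_le_one_iff.mpr ?_)
  rw [neg_div]
  exact neg_nonpos.mpr (by positivity)

lemma integrableOn_heatK_Ioi (hd : 3 ≤ d) {s : ℝ} (hs : 0 < s) (x : Esp d) :
    IntegrableOn (fun t => heatK d t x) (Set.Ioi s) := by
  refine Integrable.mono' (integrableOn_pi_div_rpow hd hs) ?_ ?_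
  · exact ((measurable_heatK_uncurry d).comp
      (measurable_const.prodMk measurable_id)).aestronglyMeasurable
  · refine (ae_restrict_iff' measurableSet_Ioi).mpr (Eventually.of_forall fun t ht => ?_)
    rw [Real.norm_of_nonneg (heatK_nonneg d (hs.trans ht) x)]
    exact heatK_le d (hs.trans ht) x

lemma tailK_le (hd : 3 ≤ d) {s : ℝ} (hs : 0 < s) (x : Esp d) :
    tailK d s x ≤ tailC d * s ^ (1 - (d : ℝ) / 2) := by
  rw [← integral_pi_div_rpow hd hs]
  exact setIntegral_mono_on (integrableOn_heatK_Ioi hd hs x) (integrableOn_pi_div_rpow hd hs)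
    measurableSet_Ioi fun t ht => heatK_le d (hs.trans ht) x

lemma coulW_eq {s : ℝ} {ξ : Esp d} (hξ : ξ ≠ 0) :
    coulW d s ξ = Real.exp (-s * ‖ξ‖ ^ 2) / ‖ξ‖ ^ 2 := by
  have hr : 0 < ‖ξ‖ := norm_pos_iff.mpr hξ
  have h := integral_exp_mul_Ioi (a := -‖ξ‖ ^ 2) (by simp; positivity) s
  unfold coulW
  have e : ∀ t : ℝ, -t * ‖ξ‖ ^ 2 = -‖ξ‖ ^ 2 * t := fun t => by ring
  simp only [e]
  rw [h, neg_div_neg_eq]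

lemma integrable_gaussian_prod (hd : 3 ≤ d) {s : ℝ} (hs : 0 < s) :
    Integrable (fun p : ℝ × Esp d => Real.exp (-p.1 * ‖p.2‖ ^ 2))
      ((volume.restrict (Set.Ioi s)).prod volume) := by
  refine (integrable_prod_iff (Continuous.aestronglyMeasurable (by fun_prop))).mpr ⟨?_, ?_⟩
  · exact (ae_restrict_iff' measurableSet_Ioi).mpr
      (Eventually.of_forall fun t ht => integrable_gaussian d (hs.trans ht))
  · refine (integrableOn_pi_div_rpow hd hs).congr_fun (fun t ht => ?_) measurableSet_Ioi
    simp only [Real.norm_eq_abs, Real.abs_exp]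
    rw [GaussianFourier.integral_rexp_neg_mul_sq_norm (hs.trans ht), finrank_euclideanSpace_fin]

lemma integrable_coulW (hd : 3 ≤ d) {s : ℝ} (hs : 0 < s) : Integrable (coulW d s) :=
  (integrable_gaussian_prod hd hs).integral_prod_right

lemma fourK_coulW (hd : 3 ≤ d) {s : ℝ} (hs : 0 < s) (x : Esp d) :
    fourK (coulW d s) x = tailK d s x := by
  have hint : Integrable (fun p : ℝ × Esp d =>
      Real.exp (-p.1 * ‖p.2‖ ^ 2) * Real.cos (inner ℝ p.2 x))
      ((volume.restrict (Set.Ioi s)).prod volume) := by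
    refine (integrable_gaussian_prod hd hs).mul_bdd (c := 1) ?_
      (Eventually.of_forall fun x => Real.abs_cos_le_one _)
    exact Continuous.aestronglyMeasurable (by fun_prop)
  have h := integral_integral_swap (μ := volume.restrict (Set.Ioi s))
    (ν := (volume : Measure (Esp d)))
    (f := fun t ξ => Real.exp (-t * ‖ξ‖ ^ 2) * Real.cos (inner ℝ ξ x)) hint
  unfold fourK tailK coulW
  simp only [← integral_mul_const]
  rw [← h]
  exact setIntegral_congr_fun measurableSet_Ioi
    fun t ht => integral_gaussian_mul_cos d (hs.trans ht) x

lemma integrable_heatK_prod {s : ℝ} :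
    Integrable (fun p : ℝ × Esp d => heatK d p.1 p.2)
      ((volume.restrict (Set.Ioc 0 s)).prod volume) := by
  refine (integrable_prod_iff ((measurable_heatK_uncurry d).comp
    measurable_swap).aestronglyMeasurable).mpr ⟨?_, ?_⟩
  · exact (ae_restrict_iff' measurableSet_Ioc).mpr
      (Eventually.of_forall fun t ht => integrable_heatK d ht.1)
  · have : IntegrableOn (fun _ : ℝ => heatMass d) (Set.Ioc 0 s) := by simp
    refine this.congr_fun (fun t ht => ?_) measurableSet_Ioc
    change heatMass d = ∫ y, ‖heatK d t y‖
    simp only [Real.norm_of_nonneg (heatK_nonneg d ht.1 _)]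
    rw [integral_heatK d ht.1]

lemma integrable_headK (s : ℝ) : Integrable (headK d s) :=
  integrable_heatK_prod.integral_prod_right

lemma integral_headK {s : ℝ} (hs : 0 < s) : ∫ x, headK d s x = s * heatMass d := by
  have h := integral_integral_swap (μ := volume.restrict (Set.Ioc 0 s))
    (ν := (volume : Measure (Esp d))) (f := fun t x => heatK d t x) integrable_heatK_prod
  unfold headK
  rw [← h, setIntegral_congr_fun (g := fun _ => heatMass d) measurableSet_Ioc
    fun t ht => integral_heatK d ht.1]
  simp [hs.le]

lemma measurable_tailK (s : ℝ) : StronglyMeasurable (tailK d s) :=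
  (measurable_heatK_uncurry d).stronglyMeasurable.integral_prod_right

end Kernel

section Energy

variable {d : ℕ} {μ : Measure (Esp d)} {M : ℝ}

lemma withDensity_le_smul {ρ : Esp d → ℝ≥0∞} (hρ : ∀ x, ρ x ≤ ENNReal.ofReal M) :
    (volume : Measure (Esp d)).withDensity ρ ≤ ENNReal.ofReal M • volume := by
  rw [← withDensity_const]
  exact withDensity_mono (Eventually.of_forall hρ)

lemma integrable_of_le_smul (hμ : μ ≤ ENNReal.ofReal M • volume) {R : Esp d → ℝ}
    (hR : Integrable R) : Integrable R μ :=
  (hR.smul_measure ENNReal.ofReal_ne_top).mono_measure hμ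

lemma integral_le_of_le_smul (hM : 0 ≤ M) (hμ : μ ≤ ENNReal.ofReal M • volume) {R : Esp d → ℝ}
    (hR : Integrable R) (h0 : ∀ x, 0 ≤ R x) : ∫ x, R x ∂μ ≤ M * ∫ x, R x := by
  have := integral_mono_measure hμ (Eventually.of_forall h0)
    (hR.smul_measure ENNReal.ofReal_ne_top)
  rwa [integral_smul_measure, ENNReal.toReal_ofReal hM] at this

lemma integrable_tailK_sub [IsFiniteMeasure μ] (hd : 3 ≤ d) {s : ℝ} (hs : 0 < s) (x : Esp d) :
    Integrable (fun y => tailK d s (x - y)) μ := by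
  refine Integrable.mono' (integrable_const (tailC d * s ^ (1 - (d : ℝ) / 2))) ?_
    (Eventually.of_forall fun y => ?_)
  · exact ((measurable_tailK s).comp_measurable (measurable_const.sub measurable_id)
      ).aestronglyMeasurable
  · rw [Real.norm_of_nonneg (tailK_nonneg hs _)]
    exact tailK_le hd hs _

lemma integrable_gC_sub [IsFiniteMeasure μ] (hd : 3 ≤ d) (hμ : μ ≤ ENNReal.ofReal M • volume)
    (x : Esp d) : Integrable (fun y => gC d (x - y)) μ := by
  have hc := coulC_pos hd
  have h1 := (integrable_tailK_sub (μ := μ) hd one_pos x).add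
    (integrable_of_le_smul hμ ((integrable_headK (d := d) 1).comp_sub_left x))
  refine Integrable.mono' (h1.const_mul (coulC d)⁻¹) ?_ (Eventually.of_forall fun y => ?_)
  · exact (measurable_gC.comp (measurable_const.sub measurable_id)).aestronglyMeasurable
  · rw [Real.norm_of_nonneg (gC_nonneg _), ← div_eq_inv_mul, le_div_iff₀ hc, mul_comm]
    exact coulC_mul_gC_le hd one_pos _

lemma coulC_mul_hpot_le [IsFiniteMeasure μ] (hd : 3 ≤ d) (hM : 0 ≤ M)
    (hμ : μ ≤ ENNReal.ofReal M • volume) {s : ℝ} (hs : 0 < s) (x : Esp d) :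
    coulC d * hpot d μ x ≤ ∫ y, tailK d s (x - y) ∂μ + M * (s * heatMass d) := by
  have h1 := (integrable_headK (d := d) s).comp_sub_left x
  have h2 : ∫ y, headK d s (x - y) ∂μ ≤ M * (s * heatMass d) := by
    have := integral_le_of_le_smul hM hμ h1 (fun y => headK_nonneg s _)
    rwa [integral_sub_left_eq_self (headK d s) volume x, integral_headK hs] at this
  have h3 : coulC d * hpot d μ x
      ≤ ∫ y, (tailK d s (x - y) + headK d s (x - y)) ∂μ := by
    unfold hpot
    rw [← integral_const_mul]
    exact integral_mono ((integrable_gC_sub hd hμ x).const_mul _)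
      ((integrable_tailK_sub hd hs x).add (integrable_of_le_smul hμ h1))
      (fun y => coulC_mul_gC_le hd hs _)
  rw [integral_add (integrable_tailK_sub hd hs x) (integrable_of_le_smul hμ h1)] at h3
  linarith

lemma integrable_gC_prod [IsFiniteMeasure μ] (hd : 3 ≤ d) (hM : 0 ≤ M)
    (hμ : μ ≤ ENNReal.ofReal M • volume) :
    Integrable (fun p : Esp d × Esp d => gC d (p.1 - p.2)) (μ.prod μ) := by
  have hc := coulC_pos hd
  have hm : Measurable (fun p : Esp d × Esp d => gC d (p.1 - p.2)) :=
    measurable_gC.comp (measurable_fst.sub measurable_snd)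
  refine (integrable_prod_iff hm.aestronglyMeasurable).mpr
    ⟨Eventually.of_forall fun x => integrable_gC_sub hd hμ x, ?_⟩
  simp only [Real.norm_of_nonneg (gC_nonneg _)]
  refine Integrable.mono' (integrable_const
    ((coulC d)⁻¹ * (μ.real Set.univ * (tailC d * 1) + M * (1 * heatMass d)))) ?_
    (Eventually.of_forall fun x => ?_)
  · exact (hm.stronglyMeasurable.integral_prod_right' (ν := μ)).aestronglyMeasurable
  · rw [Real.norm_of_nonneg (integral_nonneg fun y => gC_nonneg _), ← div_eq_inv_mul,
      le_div_iff₀ hc, mul_comm]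
    refine (coulC_mul_hpot_le hd hM hμ one_pos x).trans (add_le_add_left ?_ _)
    have := integral_mono (integrable_tailK_sub (μ := μ) hd one_pos x) (integrable_const _)
      (fun y => tailK_le hd one_pos _)
    rwa [integral_const, Real.one_rpow, smul_eq_mul] at this

lemma ae_prod_ne [IsFiniteMeasure μ] [NullSingletonClass μ] :
    ∀ᵐ p : Esp d × Esp d ∂(μ.prod μ), p.1 - p.2 ≠ 0 := by
  have hm : MeasurableSet {p : Esp d × Esp d | p.1 - p.2 ≠ 0} :=
    (measurable_fst.sub measurable_snd) (measurableSet_singleton 0).compl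
  refine (Measure.ae_prod_iff_ae_ae hm).mpr (Eventually.of_forall fun x => ?_)
  have : ∀ᵐ y ∂μ, y ≠ x := by
    rw [ae_iff]; simp
  filter_upwards [this] with y hy
  exact sub_ne_zero.mpr hy.symm

lemma noAtoms_of_le_smul (hd : 3 ≤ d) (hμ : μ ≤ ENNReal.ofReal M • volume) :
    NullSingletonClass μ := by
  have : Nonempty (Fin d) := ⟨⟨0, by omega⟩⟩
  refine ⟨fun x => le_antisymm ((hμ {x}).trans ?_) zero_le⟩
  simp

lemma integral_tailK_prod_le [IsFiniteMeasure μ] (hd : 3 ≤ d) (hM : 0 ≤ M)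
    (hμ : μ ≤ ENNReal.ofReal M • volume) {s : ℝ} (hs : 0 < s) :
    ∫ p : Esp d × Esp d, tailK d s (p.1 - p.2) ∂(μ.prod μ) ≤ coulC d * Dg d μ := by
  have := noAtoms_of_le_smul hd hμ
  unfold Dg
  rw [← integral_const_mul]
  refine integral_mono_of_nonneg (Eventually.of_forall fun p => tailK_nonneg hs _)
    ((integrable_gC_prod hd hM hμ).const_mul _) ?_
  filter_upwards [ae_prod_ne (μ := μ)] with p hp
  exact tailK_le_coulC_mul_gC hd hs hp

/-- The empirical (counting) measure of a configuration. -/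
def empM {N : ℕ} (X : Fin N → Esp d) : Measure (Esp d) := ∑ i, Measure.dirac (X i)

instance {N : ℕ} (X : Fin N → Esp d) : IsFiniteMeasure (empM X) := by
  unfold empM; infer_instance

lemma integral_empM {N : ℕ} (X : Fin N → Esp d) (f : Esp d → ℝ) :
    ∫ x, f x ∂(empM X) = ∑ i, f (X i) := by
  unfold empM
  rw [integral_finsetSum_measure fun i _ => integrable_dirac (by simp)]
  simp

/-- The squared modulus of the Fourier transform of `∑ δ_{x_i} - N μ`. -/
def flucSq {N : ℕ} (μ : Measure (Esp d)) (X : Fin N → Esp d) (ξ : Esp d) : ℝ :=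
  (cosT (empM X) 1 ξ - N * cosT μ 1 ξ) ^ 2 + (sinT (empM X) 1 ξ - N * sinT μ 1 ξ) ^ 2

lemma flucSq_eq {N : ℕ} (X : Fin N → Esp d) (ξ : Esp d) :
    flucSq μ X ξ = pairT (empM X) 1 (empM X) 1 ξ - 2 * N * pairT (empM X) 1 μ 1 ξ
      + N ^ 2 * pairT μ 1 μ 1 ξ := by
  unfold flucSq pairT; ring

lemma integrable_one [IsFiniteMeasure μ] : Integrable (1 : Esp d → ℝ) μ := integrable_const 1

lemma integrable_mul_flucSq [IsFiniteMeasure μ] {N : ℕ} (X : Fin N → Esp d) {w : Esp d → ℝ}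
    (hw : Integrable w) : Integrable (fun ξ => w ξ * flucSq μ X ξ) := by
  have h1 := integrable_mul_pairT (integrable_one (μ := empM X)) (integrable_one (μ := empM X)) hw
  have h2 := integrable_mul_pairT (integrable_one (μ := empM X)) (integrable_one (μ := μ)) hw
  have h3 := integrable_mul_pairT (integrable_one (μ := μ)) (integrable_one (μ := μ)) hw
  refine ((h1.sub (h2.const_mul (2 * N))).add (h3.const_mul (N ^ 2))).congr
    (Eventually.of_forall fun ξ => ?_)
  simp only [flucSq_eq, Pi.add_apply, Pi.sub_apply]
  ring

lemma integral_mul_flucSq [IsFiniteMeasure μ] {N : ℕ} (X : Fin N → Esp d) {w : Esp d → ℝ}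
    (hw : Integrable w) :
    ∫ ξ, w ξ * flucSq μ X ξ = ∑ i, ∑ j, fourK w (X i - X j)
      - 2 * N * ∑ i, ∫ y, fourK w (X i - y) ∂μ
      + N ^ 2 * ∫ p : Esp d × Esp d, fourK w (p.1 - p.2) ∂(μ.prod μ) := by
  have i1 := integrable_one (μ := empM X)
  have i2 := integrable_one (μ := μ)
  have h1 := integrable_mul_pairT i1 i1 hw
  have h2 := integrable_mul_pairT i1 i2 hw
  have h3 := integrable_mul_pairT i2 i2 hw
  have k1 := integrable_mul_fourK i1 i1 hw
  have k2 := integrable_mul_fourK i1 i2 hw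
  have e : ∀ ξ, w ξ * flucSq μ X ξ = w ξ * pairT (empM X) 1 (empM X) 1 ξ
      - 2 * N * (w ξ * pairT (empM X) 1 μ 1 ξ) + N ^ 2 * (w ξ * pairT μ 1 μ 1 ξ) := by
    intro ξ; rw [flucSq_eq]; ring
  have h12 : Integrable (fun ξ => w ξ * pairT (empM X) 1 (empM X) 1 ξ
      - 2 * N * (w ξ * pairT (empM X) 1 μ 1 ξ)) := h1.sub (h2.const_mul _)
  simp only [e]
  rw [integral_add h12 (h3.const_mul _), integral_sub h1 (h2.const_mul _),
    integral_const_mul, integral_const_mul, integral_mul_pairT i1 i1 hw,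
    integral_mul_pairT i1 i2 hw, integral_mul_pairT i2 i2 hw,
    integral_prod _ k1, integral_prod _ k2]
  simp only [integral_empM, Pi.one_apply, one_mul]

/-- The next-order energy as a real number, meaningful for distinct points. -/
def energyR {N : ℕ} (μ : Measure (Esp d)) (X : Fin N → Esp d) : ℝ :=
  (∑ i, ∑ j, if i ≠ j then gC d (X i - X j) else 0)
    + (-2 * N * ∑ i, hpot d μ (X i) + (N : ℝ) ^ 2 * Dg d μ)

lemma integral_coulW_mul_flucSq_le [IsFiniteMeasure μ] (hd : 3 ≤ d) (hM : 0 ≤ M)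
    (hμ : μ ≤ ENNReal.ofReal M • volume) {s : ℝ} (hs : 0 < s) {N : ℕ} (X : Fin N → Esp d)
    (hX : Function.Injective X) :
    ∫ ξ, coulW d s ξ * flucSq μ X ξ ≤ coulC d * energyR μ X
      + N * (tailC d * s ^ (1 - (d : ℝ) / 2)) + 2 * N ^ 2 * (M * (s * heatMass d)) := by
  rw [integral_mul_flucSq X (integrable_coulW hd hs)]
  simp only [fourK_coulW hd hs]
  have h1 : ∑ i, ∑ j, tailK d s (X i - X j)
      ≤ coulC d * (∑ i, ∑ j, if i ≠ j then gC d (X i - X j) else 0)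
        + N * (tailC d * s ^ (1 - (d : ℝ) / 2)) := by
    have : ∀ i j, tailK d s (X i - X j) ≤ coulC d * (if i ≠ j then gC d (X i - X j) else 0)
        + (if i = j then tailC d * s ^ (1 - (d : ℝ) / 2) else 0) := by
      intro i j
      by_cases hij : i = j
      · simpa [hij] using tailK_le hd hs 0
      · simpa [hij] using tailK_le_coulC_mul_gC hd hs (sub_ne_zero.mpr (hX.ne hij))
    refine (Finset.sum_le_sum fun i _ => Finset.sum_le_sum fun j _ => this i j).trans
      (le_of_eq ?_)
    simp only [Finset.sum_add_distrib, Finset.mul_sum]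
    simp
  have h2 : coulC d * ∑ i, hpot d μ (X i)
      ≤ ∑ i, ∫ y, tailK d s (X i - y) ∂μ + N * (M * (s * heatMass d)) := by
    rw [Finset.mul_sum]
    refine (Finset.sum_le_sum fun i _ => coulC_mul_hpot_le hd hM hμ hs (X i)).trans (le_of_eq ?_)
    simp [Finset.sum_add_distrib]
  have h3 := integral_tailK_prod_le hd hM hμ hs
  have h4 := mul_le_mul_of_nonneg_left h2 (by positivity : (0 : ℝ) ≤ 2 * N)
  have h5 := mul_le_mul_of_nonneg_left h3 (by positivity : (0 : ℝ) ≤ (N : ℝ) ^ 2)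
  unfold energyR
  linarith

lemma integral_coulW_mul_flucSq_nonneg {s : ℝ} {N : ℕ} (X : Fin N → Esp d) :
    0 ≤ ∫ ξ, coulW d s ξ * flucSq μ X ξ := by
  refine integral_nonneg fun ξ => mul_nonneg (integral_nonneg fun t => (Real.exp_pos _).le) ?_
  unfold flucSq; positivity

end Energy

lemma fourK_gaussian (d : ℕ) {t : ℝ} (ht : 0 < t) :
    fourK (fun ξ : Esp d => Real.exp (-t * ‖ξ‖ ^ 2)) = heatK d t := by
  funext x
  exact integral_gaussian_mul_cos d ht x

section TestFunction

variable {d : ℕ} {φ : Esp d → ℝ} {K : ℝ≥0}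

lemma integrable_snd_mul_sub {f k : Esp d → ℝ} (hf : Integrable f) (hk : Integrable k) :
    Integrable (fun p : Esp d × Esp d => f p.2 * k (p.1 - p.2)) (volume.prod volume) :=
  hf.convolution_integrand (ContinuousLinearMap.mul ℝ ℝ) hk

lemma integrable_fst_mul_sub {f k : Esp d → ℝ} (hf : Integrable f) (hk : Integrable k)
    (hev : ∀ x, k (-x) = k x) :
    Integrable (fun p : Esp d × Esp d => f p.1 * k (p.1 - p.2)) (volume.prod volume) := by
  refine (integrable_snd_mul_sub hf hk).swap.congr (Eventually.of_forall fun p => ?_)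
  simp only [Function.comp, Prod.fst_swap, Prod.snd_swap]
  rw [← hev, neg_sub]

lemma integral_fst_mul_sub {f k : Esp d → ℝ} (hf : Integrable f) (hk : Integrable k)
    (hev : ∀ x, k (-x) = k x) :
    ∫ p : Esp d × Esp d, f p.1 * k (p.1 - p.2) ∂(volume.prod volume)
      = (∫ x, f x) * ∫ x, k x := by
  rw [integral_prod _ (integrable_fst_mul_sub hf hk hev), ← integral_mul_const]
  congr 1 with x
  simp only [integral_const_mul]
  rw [integral_sub_left_eq_self k volume x]

lemma integral_snd_mul_sub {f k : Esp d → ℝ} (hf : Integrable f) (hk : Integrable k)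
    (hev : ∀ x, k (-x) = k x) :
    ∫ p : Esp d × Esp d, f p.2 * k (p.1 - p.2) ∂(volume.prod volume)
      = (∫ x, f x) * ∫ x, k x := by
  rw [← integral_fst_mul_sub hf hk hev, ← integral_prod_swap]
  congr 1 with p
  simp only [Prod.fst_swap, Prod.snd_swap]
  rw [← hev, neg_sub]

lemma integrable_of_lipschitz (hφ : LipschitzWith K φ) (hc : HasCompactSupport φ) :
    Integrable φ :=
  hφ.continuous.integrable_of_hasCompactSupport hc

lemma integrable_sq_of_lipschitz (hφ : LipschitzWith K φ) (hc : HasCompactSupport φ) :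
    Integrable (fun x => φ x ^ 2) := by
  have h1 : HasCompactSupport (φ * φ) := hc.mul_left
  have h2 := (hφ.continuous.mul hφ.continuous).integrable_of_hasCompactSupport (μ := volume) h1
  refine h2.congr (Eventually.of_forall fun x => ?_)
  simp only [pow_two, Pi.mul_apply]

lemma integrable_sq_sub_mul_heatK (hφ : LipschitzWith K φ) (hc : HasCompactSupport φ)
    {t : ℝ} (ht : 0 < t) :
    Integrable (fun p : Esp d × Esp d => (φ p.1 - φ p.2) ^ 2 * heatK d t (p.1 - p.2))
      (volume.prod volume) := by
  have hi := integrable_of_lipschitz hφ hc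
  have h2 := integrable_sq_of_lipschitz hφ hc
  have hk := integrable_heatK d ht
  have h := integrable_mul_fourK hi hi (integrable_gaussian d ht)
  rw [fourK_gaussian d ht] at h
  refine (((integrable_fst_mul_sub h2 hk (heatK_neg d t)).add
    (integrable_snd_mul_sub h2 hk)).sub (h.const_mul 2)).congr
    (Eventually.of_forall fun p => ?_)
  simp only [Pi.add_apply, Pi.sub_apply]
  ring

lemma two_mul_integral_gaussian_mul_pairT (hφ : LipschitzWith K φ) (hc : HasCompactSupport φ)
    {t : ℝ} (ht : 0 < t) :
    2 * ∫ ξ, Real.exp (-t * ‖ξ‖ ^ 2) * pairT volume φ volume φ ξ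
      = 2 * ((∫ x, φ x ^ 2) * heatMass d)
        - ∫ p : Esp d × Esp d, (φ p.1 - φ p.2) ^ 2 * heatK d t (p.1 - p.2)
            ∂(volume.prod volume) := by
  have hi := integrable_of_lipschitz hφ hc
  have h2 := integrable_sq_of_lipschitz hφ hc
  have hk := integrable_heatK d ht
  have e1 := integral_fst_mul_sub h2 hk (heatK_neg d t)
  have e2 := integral_snd_mul_sub h2 hk (heatK_neg d t)
  have i1 := integrable_fst_mul_sub h2 hk (heatK_neg d t)
  have i2 := integrable_snd_mul_sub h2 hk
  rw [integral_mul_pairT hi hi (integrable_gaussian d ht), fourK_gaussian d ht]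
  rw [integral_heatK d ht] at e1 e2
  have i3 : Integrable (fun p : Esp d × Esp d => φ p.1 ^ 2 * heatK d t (p.1 - p.2)
      + φ p.2 ^ 2 * heatK d t (p.1 - p.2)) (volume.prod volume) := i1.add i2
  rw [two_mul (_ * heatMass d)]
  nth_rewrite 1 [← e1]
  rw [← e2, ← integral_add i1 i2, ← integral_sub i3 (integrable_sq_sub_mul_heatK hφ hc ht),
    ← integral_const_mul]
  congr 1 with p
  ring

lemma integral_sq_sub_mul_heatK_le (hφ : LipschitzWith K φ) (hc : HasCompactSupport φ)
    {t : ℝ} (ht : 0 < t) :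
    ∫ p : Esp d × Esp d, (φ p.1 - φ p.2) ^ 2 * heatK d t (p.1 - p.2) ∂(volume.prod volume)
      ≤ 2 * K ^ 2 * (volume (tsupport φ)).toReal * (momC d * t) := by
  set T := tsupport φ with hT
  have hTm : MeasurableSet T := (isClosed_tsupport φ).measurableSet
  have hTfin : volume T ≠ ⊤ := hc.isCompact.measure_lt_top.ne
  have hf : Integrable (T.indicator (fun _ => (1 : ℝ)) : Esp d → ℝ) := by
    rw [integrable_indicator_iff hTm]
    exact integrableOn_const hTfin
  have hfi : ∫ x, T.indicator (fun _ => (1 : ℝ)) x = (volume T).toReal := by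
    rw [integral_indicator hTm]; simp [Measure.real]
  have hk := integrable_sq_mul_heatK d ht
  have hev : ∀ x : Esp d, ‖-x‖ ^ 2 * heatK d t (-x) = ‖x‖ ^ 2 * heatK d t x := by
    intro x; rw [heatK_neg, norm_neg]
  have i1 := integrable_fst_mul_sub hf hk hev
  have i2 := integrable_snd_mul_sub hf hk
  have e1 := integral_fst_mul_sub hf hk hev
  have e2 := integral_snd_mul_sub hf hk hev
  calc ∫ p : Esp d × Esp d, (φ p.1 - φ p.2) ^ 2 * heatK d t (p.1 - p.2) ∂(volume.prod volume)
      ≤ ∫ p : Esp d × Esp d, (K : ℝ) ^ 2 *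
          (T.indicator (fun _ => (1 : ℝ)) p.1 * (‖p.1 - p.2‖ ^ 2 * heatK d t (p.1 - p.2))
          + T.indicator (fun _ => (1 : ℝ)) p.2 * (‖p.1 - p.2‖ ^ 2 * heatK d t (p.1 - p.2)))
          ∂(volume.prod volume) := by
        refine integral_mono (integrable_sq_sub_mul_heatK hφ hc ht)
          ((i1.add i2).const_mul _) fun p => ?_
        simp only
        have hP := heatK_nonneg d ht (p.1 - p.2)
        have hl : (φ p.1 - φ p.2) ^ 2 ≤ (K : ℝ) ^ 2 * ‖p.1 - p.2‖ ^ 2 := by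
          have h := hφ.dist_le_mul p.1 p.2
          rw [Real.dist_eq, dist_eq_norm] at h
          rw [← sq_abs, ← mul_pow]
          exact pow_le_pow_left₀ (abs_nonneg _) h 2
        have hl' := mul_le_mul_of_nonneg_right hl hP
        have hn : 0 ≤ (K : ℝ) ^ 2 * ‖p.1 - p.2‖ ^ 2 * heatK d t (p.1 - p.2) := by positivity
        by_cases h1 : p.1 ∈ T <;> by_cases h2 : p.2 ∈ T
        · simp only [Set.indicator_of_mem h1, Set.indicator_of_mem h2]; linarith
        · simp only [Set.indicator_of_mem h1, Set.indicator_of_notMem h2]; linarith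
        · simp only [Set.indicator_of_notMem h1, Set.indicator_of_mem h2]; linarith
        · simp only [Set.indicator_of_notMem h1, Set.indicator_of_notMem h2,
            image_eq_zero_of_notMem_tsupport h1, image_eq_zero_of_notMem_tsupport h2]
          simp
    _ = 2 * K ^ 2 * (volume T).toReal * ∫ x : Esp d, ‖x‖ ^ 2 * heatK d t x := by
        rw [integral_const_mul, integral_add i1 i2, e1, e2, hfi]; ring
    _ ≤ _ := mul_le_mul_of_nonneg_left (integral_sq_mul_heatK_le d ht) (by positivity)

lemma sq_mul_gaussian_le {s : ℝ} (hs : 0 < s) (r : ℝ) :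
    r ^ 2 * Real.exp (-s * r ^ 2)
      ≤ 2 / s * (Real.exp (-(s / 2) * r ^ 2) - Real.exp (-s * r ^ 2)) := by
  have h1 := Real.add_one_le_exp (s / 2 * r ^ 2)
  have h2 : Real.exp (-(s / 2) * r ^ 2) = Real.exp (s / 2 * r ^ 2) * Real.exp (-s * r ^ 2) := by
    rw [← Real.exp_add]; congr 1; ring
  have h3 : r ^ 2 ≤ 2 / s * (Real.exp (s / 2 * r ^ 2) - 1) := by
    rw [div_mul_eq_mul_div, le_div_iff₀ hs]; linarith
  have h4 := mul_le_mul_of_nonneg_right h3 (Real.exp_pos (-s * r ^ 2)).le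
  rw [h2]
  linarith

lemma integrable_sq_mul_gaussian {s : ℝ} (hs : 0 < s) :
    Integrable (fun ξ : Esp d => ‖ξ‖ ^ 2 * Real.exp (-s * ‖ξ‖ ^ 2)) := by
  refine Integrable.mono' (((integrable_gaussian d (half_pos hs)).sub
    (integrable_gaussian d hs)).const_mul (2 / s)) ?_ (Eventually.of_forall fun ξ => ?_)
  · exact Continuous.aestronglyMeasurable (by fun_prop)
  · rw [Real.norm_of_nonneg (by positivity)]
    exact sq_mul_gaussian_le hs _

lemma pairT_self_nonneg (α : Measure (Esp d)) (f : Esp d → ℝ) (ξ : Esp d) :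
    0 ≤ pairT α f α f ξ := by
  unfold pairT
  exact add_nonneg (mul_self_nonneg _) (mul_self_nonneg _)

lemma integral_sq_mul_gaussian_mul_pairT_le (hφ : LipschitzWith K φ)
    (hc : HasCompactSupport φ) {s : ℝ} (hs : 0 < s) :
    ∫ ξ, ‖ξ‖ ^ 2 * Real.exp (-s * ‖ξ‖ ^ 2) * pairT volume φ volume φ ξ
      ≤ 2 * K ^ 2 * (volume (tsupport φ)).toReal * momC d := by
  have hi := integrable_of_lipschitz hφ hc
  have i1 := integrable_mul_pairT hi hi (integrable_gaussian d (half_pos hs))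
  have i2 := integrable_mul_pairT hi hi (integrable_gaussian d hs)
  have i3 := integrable_mul_pairT hi hi (integrable_sq_mul_gaussian (d := d) hs)
  have e1 := two_mul_integral_gaussian_mul_pairT hφ hc (half_pos hs)
  have e2 := two_mul_integral_gaussian_mul_pairT hφ hc hs
  have e3 := integral_sq_sub_mul_heatK_le hφ hc hs
  have e4 : 0 ≤ ∫ p : Esp d × Esp d, (φ p.1 - φ p.2) ^ 2 * heatK d (s / 2) (p.1 - p.2)
      ∂(volume.prod volume) :=
    integral_nonneg fun p => mul_nonneg (sq_nonneg _) (heatK_nonneg d (half_pos hs) _)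
  have h : ∫ ξ, ‖ξ‖ ^ 2 * Real.exp (-s * ‖ξ‖ ^ 2) * pairT volume φ volume φ ξ
      ≤ ∫ ξ : Esp d, 2 / s * (Real.exp (-(s / 2) * ‖ξ‖ ^ 2) * pairT volume φ volume φ ξ
        - Real.exp (-s * ‖ξ‖ ^ 2) * pairT volume φ volume φ ξ) := by
    refine integral_mono i3 ((i1.sub i2).const_mul _) fun ξ => ?_
    have := mul_le_mul_of_nonneg_right (sq_mul_gaussian_le hs ‖ξ‖)
      (pairT_self_nonneg volume φ ξ)
    simp only
    linarith
  rw [integral_const_mul, integral_sub i1 i2] at h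
  refine h.trans ?_
  rw [div_mul_eq_mul_div, div_le_iff₀ hs]
  linarith

lemma norm_mul_heatK_le {s : ℝ} (hs : 0 < s) (x : Esp d) :
    ‖x‖ * heatK d s x
      ≤ √s / 2 * heatK d s x + 1 / (2 * √s) * (‖x‖ ^ 2 * heatK d s x) := by
  have hr := Real.sqrt_pos.mpr hs
  have h : ‖x‖ ≤ √s / 2 + 1 / (2 * √s) * ‖x‖ ^ 2 := by
    have : √s / 2 + 1 / (2 * √s) * ‖x‖ ^ 2 - ‖x‖ = (√s - ‖x‖) ^ 2 / (2 * √s) := by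
      field_simp; ring
    have h2 : 0 ≤ (√s - ‖x‖) ^ 2 / (2 * √s) := by positivity
    linarith
  have := mul_le_mul_of_nonneg_right h (heatK_nonneg d hs x)
  linarith

/-- The smoothing of `φ` by the heat kernel. -/
def heatSmooth (s : ℝ) (φ : Esp d → ℝ) (x : Esp d) : ℝ := ∫ y, φ y * heatK d s (y - x)

lemma abs_heatSmooth_sub_le (hφ : LipschitzWith K φ) (hc : HasCompactSupport φ)
    {s : ℝ} (hs : 0 < s) (x : Esp d) :
    |heatSmooth s φ x - heatMass d * φ x| ≤ K * √s * (heatMass d + momC d) / 2 := by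
  have hr := Real.sqrt_pos.mpr hs
  have hk := (integrable_heatK d hs).comp_sub_right x
  have hk2 := (integrable_sq_mul_heatK d hs).comp_sub_right x
  have i1 : Integrable (fun y => φ y * heatK d s (y - x)) := by
    refine (hk.bdd_mul (c := (hc.exists_bound_of_continuous hφ.continuous).choose)
      hφ.continuous.aestronglyMeasurable (Eventually.of_forall
      (hc.exists_bound_of_continuous hφ.continuous).choose_spec))
  have e1 : heatSmooth s φ x - heatMass d * φ x
      = ∫ y, (φ y - φ x) * heatK d s (y - x) := by
    have : ∫ y, φ x * heatK d s (y - x) = heatMass d * φ x := by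
      rw [integral_const_mul, integral_sub_right_eq_self (heatK d s) x, integral_heatK d hs,
        mul_comm]
    rw [heatSmooth, ← this, ← integral_sub i1 (hk.const_mul _)]
    congr 1 with y
    ring
  rw [e1]
  have h1 : |∫ y, (φ y - φ x) * heatK d s (y - x)|
      ≤ ∫ y, (K : ℝ) * (√s / 2 * heatK d s (y - x)
        + 1 / (2 * √s) * (‖y - x‖ ^ 2 * heatK d s (y - x))) := by
    rw [← Real.norm_eq_abs]
    refine norm_integral_le_of_norm_le (((hk.const_mul _).add (hk2.const_mul _)).const_mul _)
      (Eventually.of_forall fun y => ?_)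
    rw [norm_mul, Real.norm_of_nonneg (heatK_nonneg d hs _)]
    have h := hφ.dist_le_mul y x
    rw [Real.dist_eq, dist_eq_norm] at h
    calc ‖φ y - φ x‖ * heatK d s (y - x) ≤ (K * ‖y - x‖) * heatK d s (y - x) :=
          mul_le_mul_of_nonneg_right h (heatK_nonneg d hs _)
      _ = K * (‖y - x‖ * heatK d s (y - x)) := by ring
      _ ≤ _ := mul_le_mul_of_nonneg_left (norm_mul_heatK_le hs _) K.2
  refine h1.trans ?_
  rw [integral_const_mul, integral_add (hk.const_mul _) (hk2.const_mul _), integral_const_mul,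
    integral_const_mul, integral_sub_right_eq_self (heatK d s) x, integral_heatK d hs,
    integral_sub_right_eq_self (fun y => ‖y‖ ^ 2 * heatK d s y) x]
  have h2 : 1 / (2 * √s) * ∫ y : Esp d, ‖y‖ ^ 2 * heatK d s y ≤ √s / 2 * momC d := by
    calc 1 / (2 * √s) * ∫ y : Esp d, ‖y‖ ^ 2 * heatK d s y ≤ 1 / (2 * √s) * (momC d * s) :=
          mul_le_mul_of_nonneg_left (integral_sq_mul_heatK_le d hs) (by positivity)
      _ = √s / 2 * momC d := by
          nth_rewrite 2 [← Real.sq_sqrt hs.le]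
          field_simp
  calc (K : ℝ) * (√s / 2 * heatMass d + 1 / (2 * √s) * ∫ y : Esp d, ‖y‖ ^ 2 * heatK d s y)
      ≤ K * (√s / 2 * heatMass d + √s / 2 * momC d) := by gcongr
    _ = _ := by ring

end TestFunction

section Fluctuation

variable {d : ℕ} {μ : Measure (Esp d)} {φ : Esp d → ℝ} {K : ℝ≥0}

lemma integral_gaussian_mul_pairT_one [IsFiniteMeasure μ] (hφ : Integrable φ) {s : ℝ}
    (hs : 0 < s) :
    ∫ ξ, Real.exp (-s * ‖ξ‖ ^ 2) * pairT volume φ μ 1 ξ = ∫ x, heatSmooth s φ x ∂μ := by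
  have i1 := integrable_one (μ := μ)
  have k := integrable_mul_fourK hφ i1 (integrable_gaussian d hs)
  rw [integral_mul_pairT hφ i1 (integrable_gaussian d hs), integral_prod_symm _ k,
    fourK_gaussian d hs]
  simp only [Pi.one_apply, mul_one]
  rfl

lemma integrable_heatSmooth [IsFiniteMeasure μ] (hφ : Integrable φ) {s : ℝ} (hs : 0 < s) :
    Integrable (heatSmooth s φ) μ := by
  have k := integrable_mul_fourK hφ (integrable_one (μ := μ)) (integrable_gaussian d hs)
  rw [fourK_gaussian d hs] at k
  refine k.integral_prod_right.congr (Eventually.of_forall fun x => ?_)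
  simp only [Pi.one_apply, mul_one]
  rfl

lemma sq_integral_gaussian_mul_pairT_le [IsFiniteMeasure μ] (hd : 3 ≤ d) (hφ : Integrable φ)
    {s : ℝ} (hs : 0 < s) {N : ℕ} (X : Fin N → Esp d) :
    (∫ x, heatSmooth s φ x ∂(empM X) - N * ∫ x, heatSmooth s φ x ∂μ) ^ 2
      ≤ (∫ ξ, ‖ξ‖ ^ 2 * Real.exp (-s * ‖ξ‖ ^ 2) * pairT volume φ volume φ ξ)
        * ∫ ξ, coulW d s ξ * flucSq μ X ξ := by
  have h1 := integrable_mul_pairT hφ (integrable_one (μ := empM X)) (integrable_gaussian d hs)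
  have h2 := integrable_mul_pairT hφ (integrable_one (μ := μ)) (integrable_gaussian d hs)
  have h3 := integrable_mul_pairT hφ hφ (integrable_sq_mul_gaussian (d := d) hs)
  have h4 := integrable_mul_flucSq (μ := μ) X (integrable_coulW hd hs)
  rw [← integral_gaussian_mul_pairT_one hφ hs, ← integral_gaussian_mul_pairT_one hφ hs,
    ← integral_const_mul, ← integral_sub h1 (h2.const_mul _)]
  set u := fun ξ : Esp d => ‖ξ‖ ^ 2 * Real.exp (-s * ‖ξ‖ ^ 2) * pairT volume φ volume φ ξ with hu
  set q := fun ξ : Esp d => coulW d s ξ * flucSq μ X ξ with hq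
  set v := fun ξ : Esp d => Real.exp (-s * ‖ξ‖ ^ 2) * pairT volume φ (empM X) 1 ξ
    - N * (Real.exp (-s * ‖ξ‖ ^ 2) * pairT volume φ μ 1 ξ) with hv
  have iv : Integrable v := h1.sub (h2.const_mul _)
  have key : ∀ l : ℝ, 0 ≤ (∫ ξ, u ξ) * (l * l) + (2 * ∫ ξ, v ξ) * l + ∫ ξ, q ξ := by
    intro l
    have e : (∫ ξ, u ξ) * (l * l) + (2 * ∫ ξ, v ξ) * l + ∫ ξ, q ξ
        = ∫ ξ, (u ξ * (l * l) + v ξ * (2 * l) + q ξ) := by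
      have j : Integrable (fun ξ => u ξ * (l * l) + v ξ * (2 * l)) :=
        (h3.mul_const _).add (iv.mul_const _)
      rw [integral_add j h4, integral_add (h3.mul_const _) (iv.mul_const _),
        integral_mul_const, integral_mul_const]
      ring
    rw [e]
    have hne : Nonempty (Fin d) := ⟨⟨0, by omega⟩⟩
    have hae : ∀ᵐ ξ : Esp d, ξ ≠ 0 := by
      rw [ae_iff]; simp
    refine integral_nonneg_of_ae ?_
    filter_upwards [hae] with ξ hξ
    have hr : 0 < ‖ξ‖ := norm_pos_iff.mpr hξ
    have e2 : u ξ * (l * l) + v ξ * (2 * l) + q ξ = Real.exp (-s * ‖ξ‖ ^ 2) *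
        ((l * ‖ξ‖ * cosT volume φ ξ + (cosT (empM X) 1 ξ - N * cosT μ 1 ξ) / ‖ξ‖) ^ 2
        + (l * ‖ξ‖ * sinT volume φ ξ + (sinT (empM X) 1 ξ - N * sinT μ 1 ξ) / ‖ξ‖) ^ 2) := by
      simp only [hu, hv, hq, pairT, flucSq, coulW_eq hξ]
      field_simp
      ring
    simp only [Pi.zero_apply, e2]
    positivity
  have := discrim_le_zero key
  unfold discrim at this
  linarith

lemma heatMass_mul_abs_fluctInt_le [IsProbabilityMeasure μ] (hφ : LipschitzWith K φ)
    (hc : HasCompactSupport φ) {s : ℝ} (hs : 0 < s) {N : ℕ} (X : Fin N → Esp d) :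
    heatMass d * |fluctInt d N μ X φ|
      ≤ |∫ x, heatSmooth s φ x ∂(empM X) - N * ∫ x, heatSmooth s φ x ∂μ|
        + K * (N * √s) * (heatMass d + momC d) := by
  have hi : Integrable φ μ := by
    obtain ⟨B, hB⟩ := hc.exists_bound_of_continuous hφ.continuous
    exact Integrable.mono' (integrable_const B) hφ.continuous.aestronglyMeasurable
      (Eventually.of_forall hB)
  have hsm := integrable_heatSmooth (μ := μ) (integrable_of_lipschitz hφ hc) hs
  set b : ℝ := K * √s * (heatMass d + momC d) / 2 with hb
  have h1 : |∑ i, (heatSmooth s φ (X i) - heatMass d * φ (X i))| ≤ N * b := by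
    refine (Finset.abs_sum_le_sum_abs _ _).trans ?_
    refine (Finset.sum_le_sum fun i _ => abs_heatSmooth_sub_le hφ hc hs (X i)).trans ?_
    simp [hb]
  have h2 : |∫ x, (heatSmooth s φ x - heatMass d * φ x) ∂μ| ≤ b := by
    have hb' : ∀ x, ‖heatSmooth s φ x - heatMass d * φ x‖ ≤ b := fun x => by
      rw [Real.norm_eq_abs]; exact abs_heatSmooth_sub_le hφ hc hs x
    simpa using norm_integral_le_of_norm_le (μ := μ) (integrable_const b)
      (Eventually.of_forall hb')
  rw [integral_sub hsm (hi.const_mul _), integral_const_mul] at h2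
  rw [Finset.sum_sub_distrib, ← Finset.mul_sum] at h1
  have h3 : |N * (∫ x, heatSmooth s φ x ∂μ - heatMass d * ∫ x, φ x ∂μ)| ≤ N * b := by
    rw [abs_mul, Nat.abs_cast]
    exact mul_le_mul_of_nonneg_left h2 (Nat.cast_nonneg N)
  have e : heatMass d * fluctInt d N μ X φ
      = (∫ x, heatSmooth s φ x ∂(empM X) - N * ∫ x, heatSmooth s φ x ∂μ)
        - (∑ i, heatSmooth s φ (X i) - heatMass d * ∑ i, φ (X i))
        + N * (∫ x, heatSmooth s φ x ∂μ - heatMass d * ∫ x, φ x ∂μ) := by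
    rw [integral_empM, fluctInt]; ring
  have h4 : K * (N * √s) * (heatMass d + momC d) = N * b + N * b := by rw [hb]; ring
  rw [← abs_of_pos (heatMass_pos d), ← abs_mul, abs_of_pos (heatMass_pos d), e, h4]
  refine (abs_add_le _ _).trans ?_
  have := abs_sub (∫ x, heatSmooth s φ x ∂(empM X) - N * ∫ x, heatSmooth s φ x ∂μ)
    (∑ i, heatSmooth s φ (X i) - heatMass d * ∑ i, φ (X i))
  linarith

lemma FN3_eq_energyR (hd : 3 ≤ d) {N : ℕ} {X : Fin N → Esp d} (h : FN3 d N μ X ≠ ⊤) :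
    Function.Injective X ∧ FN3 d N μ X = (energyR μ X : EReal) := by
  have hd' : (3 : ℝ) ≤ d := by exact_mod_cast hd
  have hS : (∑ i, ∑ j, if i ≠ j then coulK d (X i - X j) else 0) ≠ ⊤ := by
    intro hS
    apply h
    rw [FN3, hS, EReal.coe_ennreal_top, EReal.top_add_coe]
  have hX : Function.Injective X := by
    intro i j hij
    by_contra hne
    apply hS
    rw [ENNReal.sum_eq_top]
    refine ⟨i, Finset.mem_univ _, ?_⟩
    rw [ENNReal.sum_eq_top]
    refine ⟨j, Finset.mem_univ _, ?_⟩
    rw [if_pos hne, hij, sub_self, coulK, norm_zero, ENNReal.ofReal_zero,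
      ENNReal.zero_rpow_of_neg (by linarith)]
  refine ⟨hX, ?_⟩
  have hterm : ∀ i j, (if i ≠ j then coulK d (X i - X j) else 0)
      = ENNReal.ofReal (if i ≠ j then gC d (X i - X j) else 0) := by
    intro i j
    by_cases hij : i = j
    · simp [hij]
    · rw [if_pos hij, if_pos hij, coulK, gC, ENNReal.ofReal_rpow_of_pos
        (norm_pos_iff.mpr (sub_ne_zero.mpr (hX.ne hij)))]
  have h0 : ∀ i j, 0 ≤ (if i ≠ j then gC d (X i - X j) else 0) := by
    intro i j
    split_ifs
    · exact gC_nonneg _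
    · exact le_rfl
  have hsum : (∑ i, ∑ j, if i ≠ j then coulK d (X i - X j) else 0)
      = ENNReal.ofReal (∑ i, ∑ j, if i ≠ j then gC d (X i - X j) else 0) := by
    rw [ENNReal.ofReal_sum_of_nonneg fun i _ => Finset.sum_nonneg fun j _ => h0 i j]
    refine Finset.sum_congr rfl fun i _ => ?_
    rw [ENNReal.ofReal_sum_of_nonneg fun j _ => h0 i j]
    exact Finset.sum_congr rfl fun j _ => hterm i j
  rw [FN3, hsum, EReal.coe_ennreal_ofReal, max_eq_left
    (Finset.sum_nonneg fun i _ => Finset.sum_nonneg fun j _ => h0 i j), energyR]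
  exact (EReal.coe_add _ _).symm

lemma exists_smoothing_time (hd : 3 ≤ d) (N : ℕ) :
    ∃ s : ℝ, 0 < s ∧ N * s ^ (1 - (d : ℝ) / 2) = (N : ℝ) ^ (2 - 2 / (d : ℝ)) ∧
      (N : ℝ) ^ 2 * s = (N : ℝ) ^ (2 - 2 / (d : ℝ)) ∧
      N * √s = (N : ℝ) ^ (1 - 1 / (d : ℝ)) := by
  have hd' : (3 : ℝ) ≤ d := by exact_mod_cast hd
  have h2 : 2 / (d : ℝ) < 2 := by rw [div_lt_iff₀ (by linarith)]; linarith
  have h1 : 1 / (d : ℝ) < 1 := by rw [div_lt_iff₀ (by linarith)]; linarith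
  rcases Nat.eq_zero_or_pos N with rfl | hN
  · refine ⟨1, one_pos, ?_⟩
    rw [Nat.cast_zero, Real.zero_rpow (by linarith), Real.zero_rpow (by linarith)]
    simp
  · have hN' : (0 : ℝ) < N := by exact_mod_cast hN
    refine ⟨(N : ℝ) ^ (-(2 / (d : ℝ))), by positivity, ?_, ?_, ?_⟩
    · rw [← Real.rpow_mul hN'.le, ← Real.rpow_one_add' hN'.le]
      · congr 1; field_simp; ring
      · have : 1 + -(2 / (d : ℝ)) * (1 - d / 2) = 2 - 2 / d := by field_simp; ring
        rw [this]; linarith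
    · rw [← Real.rpow_natCast, ← Real.rpow_add hN']
      congr 1
    · rw [Real.sqrt_eq_rpow, ← Real.rpow_mul hN'.le]
      nth_rewrite 1 [← Real.rpow_one (N : ℝ)]
      rw [← Real.rpow_add hN']
      congr 1
      ring

/-- The constant in front of `M N^{2-2/d}` in the lower bound of the next-order energy. -/
def lowerC (d : ℕ) (M : ℝ) : ℝ := (tailC d / M + 2 * heatMass d) / coulC d

lemma lowerC_pos (hd : 3 ≤ d) {M : ℝ} (hM : 0 ≤ M) : 0 < lowerC d M := by
  have := tailC_pos hd
  have := heatMass_pos d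
  have := coulC_pos hd
  unfold lowerC; positivity

lemma integral_coulW_mul_flucSq_le_lowerC [IsFiniteMeasure μ] (hd : 3 ≤ d) {M : ℝ} (hM : 0 < M)
    (hμ : μ ≤ ENNReal.ofReal M • volume) {N : ℕ} (X : Fin N → Esp d)
    (hX : Function.Injective X) {s : ℝ} (hs : 0 < s)
    (hs1 : N * s ^ (1 - (d : ℝ) / 2) = (N : ℝ) ^ (2 - 2 / (d : ℝ)))
    (hs2 : (N : ℝ) ^ 2 * s = (N : ℝ) ^ (2 - 2 / (d : ℝ))) :
    ∫ ξ, coulW d s ξ * flucSq μ X ξ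
      ≤ coulC d * (energyR μ X + lowerC d M * M * (N : ℝ) ^ (2 - 2 / (d : ℝ))) := by
  have hc := coulC_pos hd
  refine (integral_coulW_mul_flucSq_le hd hM.le hμ hs X hX).trans (le_of_eq ?_)
  have e1 : N * (tailC d * s ^ (1 - (d : ℝ) / 2)) = tailC d * (N : ℝ) ^ (2 - 2 / (d : ℝ)) := by
    rw [← hs1]; ring
  have e2 : 2 * (N : ℝ) ^ 2 * (M * (s * heatMass d))
      = 2 * M * heatMass d * (N : ℝ) ^ (2 - 2 / (d : ℝ)) := by
    rw [← hs2]; ring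
  rw [e1, e2, lowerC]
  field_simp
  ring

/-- The constant in the fluctuation bound. -/
def flucC (d : ℕ) : ℝ := (√(2 * momC d * coulC d) + (heatMass d + momC d)) / heatMass d

lemma flucC_pos : 0 < flucC d := by
  have := heatMass_pos d
  have := momC_pos d
  unfold flucC; positivity

lemma abs_fluctInt_le [IsProbabilityMeasure μ] (hd : 3 ≤ d) {M : ℝ} (hM : 0 < M)
    (hμ : μ ≤ ENNReal.ofReal M • volume) {N : ℕ} (X : Fin N → Esp d)
    (hX : Function.Injective X) (hφ : LipschitzWith K φ) (hc : HasCompactSupport φ) :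
    |fluctInt d N μ X φ| ≤ flucC d * K * ((volume (tsupport φ)).toReal ^ ((1 : ℝ) / 2) *
        √(energyR μ X + lowerC d M * M * (N : ℝ) ^ (2 - 2 / (d : ℝ)))
      + (N : ℝ) ^ (1 - 1 / (d : ℝ))) := by
  obtain ⟨s, hs, hs1, hs2, hs3⟩ := exists_smoothing_time hd N
  have hm := heatMass_pos d
  have hmo := momC_pos d
  have hcc := coulC_pos hd
  have h1 := heatMass_mul_abs_fluctInt_le (μ := μ) hφ hc hs X
  have h2 := sq_integral_gaussian_mul_pairT_le (μ := μ) hd (integrable_of_lipschitz hφ hc) hs X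
  have h3 := integral_sq_mul_gaussian_mul_pairT_le hφ hc hs
  have h4 := integral_coulW_mul_flucSq_le_lowerC hd hM hμ X hX hs hs1 hs2
  have h5 := integral_coulW_mul_flucSq_nonneg (μ := μ) (s := s) X
  set G := energyR μ X + lowerC d M * M * (N : ℝ) ^ (2 - 2 / (d : ℝ)) with hG
  set V := (volume (tsupport φ)).toReal with hV
  set I := ∫ x, heatSmooth s φ x ∂(empM X) - N * ∫ x, heatSmooth s φ x ∂μ with hI
  have hV0 : 0 ≤ V := ENNReal.toReal_nonneg
  have hG0 : 0 ≤ G := nonneg_of_mul_nonneg_right (h5.trans h4) hcc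
  have h6 : I ^ 2 ≤ (2 * momC d * coulC d) * (K ^ 2 * (V * G)) := by
    refine h2.trans ((mul_le_mul h3 h4 h5 (by positivity)).trans (le_of_eq (by ring)))
  have h7 : |I| ≤ √(2 * momC d * coulC d) * (K * (√V * √G)) := by
    have := Real.abs_le_sqrt h6
    have hpos : 0 ≤ 2 * momC d * coulC d := by positivity
    rwa [Real.sqrt_mul hpos, Real.sqrt_mul (sq_nonneg (K : ℝ)),
      Real.sqrt_sq (NNReal.coe_nonneg K), Real.sqrt_mul hV0] at this
  rw [hs3] at h1
  rw [← Real.sqrt_eq_rpow]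
  have hP : 0 ≤ (N : ℝ) ^ (1 - 1 / (d : ℝ)) := by positivity
  have h8 : heatMass d * |fluctInt d N μ X φ|
      ≤ (√(2 * momC d * coulC d) + (heatMass d + momC d)) *
        (K * (√V * √G + (N : ℝ) ^ (1 - 1 / (d : ℝ)))) := by
    have a1 : 0 ≤ √(2 * momC d * coulC d) * (K * (N : ℝ) ^ (1 - 1 / (d : ℝ))) := by positivity
    have a2 : 0 ≤ (heatMass d + momC d) * (K * (√V * √G)) := by positivity
    linarith
  rw [flucC, div_mul_eq_mul_div, div_mul_eq_mul_div, le_div_iff₀ hm]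
  linarith

lemma pos_of_le_smul [IsProbabilityMeasure μ] {M : ℝ} (hM : 0 ≤ M)
    (hμ : μ ≤ ENNReal.ofReal M • volume) : 0 < M := by
  refine lt_of_le_of_ne hM fun h => ?_
  have := hμ Set.univ
  rw [← h] at this
  simp at this

end Fluctuation

/-- the electric energy controls the fluctuations: in dimension `d ≥ 3`, for
`μ` a probability measure with density bounded by `M`, `F_N^μ + C₀ M N^{2-2/d} ≥ 0`, and
for every compactly supported Lipschitz `φ`,
`|∫ φ dfluct_N| ≤ C ‖∇φ‖_∞ (|supp φ|^{1/2} (F_N^μ + C₀ M N^{2-2/d})^{1/2} + N^{1-1/d})`. -/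
theorem statement_9 (d : ℕ) (hd : 3 ≤ d) (M : ℝ) (hM : 0 ≤ M) :
    ∃ C : ℝ, 0 < C ∧ ∃ C₀ : ℝ, 0 < C₀ ∧
      ∀ (μ : Measure (Esp d)) (ρ : Esp d → ℝ≥0∞),
        IsProbabilityMeasure μ → μ = volume.withDensity ρ →
        (∀ x, ρ x ≤ ENNReal.ofReal M) →
        ∀ (N : ℕ) (X : Fin N → Esp d) (φ : Esp d → ℝ) (K : ℝ≥0),
          LipschitzWith K φ → HasCompactSupport φ →
          (0 : EReal) ≤ FN3 d N μ X + ((C₀ * M * (N : ℝ) ^ (2 - 2 / (d : ℝ)) : ℝ) : EReal) ∧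
          (FN3 d N μ X ≠ ⊤ →
            |fluctInt d N μ X φ| ≤
              C * K * ((volume (tsupport φ)).toReal ^ ((1 : ℝ) / 2) *
                  Real.sqrt ((FN3 d N μ X).toReal + C₀ * M * (N : ℝ) ^ (2 - 2 / (d : ℝ)))
                + (N : ℝ) ^ (1 - 1 / (d : ℝ)))) := by
  refine ⟨flucC d, flucC_pos, lowerC d M, lowerC_pos hd hM, ?_⟩
  intro μ ρ hprob hμρ hρ N X φ K hφ hc
  have hμ : μ ≤ ENNReal.ofReal M • volume := hμρ ▸ withDensity_le_smul hρ
  have hM' : 0 < M := pos_of_le_smul hM hμ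
  constructor
  · by_cases h : FN3 d N μ X = ⊤
    · rw [h, EReal.top_add_coe]; exact le_top
    · obtain ⟨hX, he⟩ := FN3_eq_energyR hd h
      obtain ⟨s, hs, hs1, hs2, -⟩ := exists_smoothing_time hd N
      have h4 := integral_coulW_mul_flucSq_le_lowerC hd hM' hμ X hX hs hs1 hs2
      have h5 := integral_coulW_mul_flucSq_nonneg (μ := μ) (s := s) X
      rw [he, ← EReal.coe_add]
      exact EReal.coe_nonneg.mpr (nonneg_of_mul_nonneg_right (h5.trans h4) (coulC_pos hd))
  · intro h
    obtain ⟨hX, he⟩ := FN3_eq_energyR hd h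
    rw [he, EReal.toReal_coe]
    exact abs_fluctInt_le hd hM' hμ X hX hφ hc
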